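/- For any variable-length random number generation algorithm φ that exactly generates Y^n from the coin process X (i.e., satisfies the validity condition) with stopping time T, and any integer m ≥ 0, there exists a fixed-length random number generation algorithm ψ : 𝒳^m → 𝒴^n such that the approximation error satisfies Δ_m = ‖P_{ψ(X^m)} − P_{Y^n}‖_1 ≤ Pr(T > m). -/

import Mathlib

open MeasureTheory Filter
open scoped ENNReal Classical

noncomputable section

namespace RNG

variable {𝒳 𝒴 : Type*}

/-- The length-`m` prefix of an infinite sequence, as a tuple. -/
def pre (ω : ℕ → 𝒳) (m : ℕ) : Fin m → 𝒳 := fun i => ω i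

/-- The length-`m` prefix of an infinite sequence, as a list. -/
def preL (ω : ℕ → 𝒳) (m : ℕ) : List 𝒳 := (List.range m).map ω

/-- `P_{X^m}(x^m)` : the probability of the cylinder set of a finite string `x^m`,
for a process with law `μ`. -/
def cylP [MeasurableSpace 𝒳] (μ : Measure (ℕ → 𝒳)) {m : ℕ} (x : Fin m → 𝒳) : ℝ :=
  (μ {ω | ∀ i : Fin m, ω i = x i}).toReal

/-- Validity (exact generation) of an algorithm `φ` (given as a full-tree function on finite
coin strings, `none` playing the role of `⊥`): for every target value `y`, the probability
that the algorithm terminates with output `y` equals `PY y`. -/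
def Valid {B : Type*} [MeasurableSpace 𝒳] (μ : Measure (ℕ → 𝒳)) (PY : B → ℝ)
    (φ : List 𝒳 → Option B) : Prop :=
  ∀ y : B,
    (μ {ω | ∃ i : ℕ, φ (preL ω i) = some y ∧ ∀ j < i, φ (preL ω j) = none}).toReal = PY y

/-- Strict lexicographic order on strings. -/
def lexLt [LT 𝒳] {m : ℕ} (x' x : Fin m → 𝒳) : Prop :=
  ∃ i : Fin m, (∀ j : Fin m, j < i → x' j = x j) ∧ x' i < x i

/-- The subinterval of `[0,1)` assigned to the string `x` by the interval algorithm: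
strings are arranged in lexicographic order, `x` receiving an interval of length `P x`. -/
def itv [LT 𝒳] [Fintype 𝒳] {m : ℕ} (P : (Fin m → 𝒳) → ℝ) (x : Fin m → 𝒳) : Set ℝ :=
  Set.Ico (∑ x' ∈ Finset.univ.filter (fun x' => lexLt x' x), P x')
    ((∑ x' ∈ Finset.univ.filter (fun x' => lexLt x' x), P x') + P x)

/-- The interval algorithm generating `Y^n` (target law `ν`) from the coin process `μ`
has stopped after at most `m` coin symbols on the sample `ω`, i.e. the coin interval
`I_{x^m}` is contained in some target interval `J_{y^n}`. -/
def IntStopped [LinearOrder 𝒳] [Fintype 𝒳] [LinearOrder 𝒴] [Fintype 𝒴]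
    [MeasurableSpace 𝒳] [MeasurableSpace 𝒴]
    (μ : Measure (ℕ → 𝒳)) (ν : Measure (ℕ → 𝒴)) (n m : ℕ) (ω : ℕ → 𝒳) : Prop :=
  ∃ y : Fin n → 𝒴, itv (fun x : Fin m → 𝒳 => cylP μ x) (pre ω m)
      ⊆ itv (fun y' : Fin n → 𝒴 => cylP ν y') y

/-- A rate `R` is achievable by the interval algorithm:
`Pr(T_n > nR) → 0` (the stopping time `T_n` is `ℕ`-valued, so `T_n > nR ↔ T_n > ⌊nR⌋`). -/
def IntAchievable [LinearOrder 𝒳] [Fintype 𝒳] [LinearOrder 𝒴] [Fintype 𝒴]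
    [MeasurableSpace 𝒳] [MeasurableSpace 𝒴]
    (μ : Measure (ℕ → 𝒳)) (ν : Measure (ℕ → 𝒴)) (R : ℝ) : Prop :=
  0 ≤ R ∧ Tendsto (fun n : ℕ =>
      (μ {ω | ¬ IntStopped μ ν n ⌊(n : ℝ) * R⌋₊ ω}).toReal) atTop (nhds 0)

/-- `R⋆_int(X,Y)` : the infimum rate achievable by the interval algorithm. -/
def Rint [LinearOrder 𝒳] [Fintype 𝒳] [LinearOrder 𝒴] [Fintype 𝒴]
    [MeasurableSpace 𝒳] [MeasurableSpace 𝒴]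
    (μ : Measure (ℕ → 𝒳)) (ν : Measure (ℕ → 𝒴)) : ℝ :=
  sInf {R : ℝ | IntAchievable μ ν R}

/-- A rate `R` is achievable by some sequence of valid algorithms: for each `n` there is a
valid algorithm `φ n` generating `Y^n` and `Pr(T_n > nR) → 0`. -/
def Achievable [MeasurableSpace 𝒳] [MeasurableSpace 𝒴]
    (μ : Measure (ℕ → 𝒳)) (ν : Measure (ℕ → 𝒴)) (R : ℝ) : Prop :=
  0 ≤ R ∧ ∃ φ : (n : ℕ) → List 𝒳 → Option (Fin n → 𝒴),
    (∀ n : ℕ, Valid μ (fun y : Fin n → 𝒴 => cylP ν y) (φ n)) ∧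
    Tendsto (fun n : ℕ =>
      (μ {ω | ∀ i ≤ ⌊(n : ℝ) * R⌋₊, φ n (preL ω i) = none}).toReal) atTop (nhds 0)

/-- `R⋆(X,Y)` : the infimum rate achievable over all valid algorithms. -/
def Rstar [MeasurableSpace 𝒳] [MeasurableSpace 𝒴]
    (μ : Measure (ℕ → 𝒳)) (ν : Measure (ℕ → 𝒴)) : ℝ :=
  sInf {R : ℝ | Achievable μ ν R}

/-- The expected stopping time `E[T_n]` of the interval algorithm, via `E[T] = ∑_m Pr(T>m)`. -/
def intAvgT [LinearOrder 𝒳] [Fintype 𝒳] [LinearOrder 𝒴] [Fintype 𝒴]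
    [MeasurableSpace 𝒳] [MeasurableSpace 𝒴]
    (μ : Measure (ℕ → 𝒳)) (ν : Measure (ℕ → 𝒴)) (n : ℕ) : ℝ≥0∞ :=
  ∑' m : ℕ, μ {ω | ¬ IntStopped μ ν n m ω}

/-- A rate `L` is average achievable by the interval algorithm: `limsup E[T_n]/n ≤ L`. -/
def IntAvgAchievable [LinearOrder 𝒳] [Fintype 𝒳] [LinearOrder 𝒴] [Fintype 𝒴]
    [MeasurableSpace 𝒳] [MeasurableSpace 𝒴]
    (μ : Measure (ℕ → 𝒳)) (ν : Measure (ℕ → 𝒴)) (L : ℝ≥0∞) : Prop :=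
  limsup (fun n : ℕ => intAvgT μ ν n / (n : ℝ≥0∞)) atTop ≤ L

/-- `L⋆_int(X,Y)` : the infimum average achievable rate of the interval algorithm. -/
def Lint [LinearOrder 𝒳] [Fintype 𝒳] [LinearOrder 𝒴] [Fintype 𝒴]
    [MeasurableSpace 𝒳] [MeasurableSpace 𝒴]
    (μ : Measure (ℕ → 𝒳)) (ν : Measure (ℕ → 𝒴)) : ℝ≥0∞ :=
  sInf {L : ℝ≥0∞ | IntAvgAchievable μ ν L}

/-- A rate `L` is average achievable by some sequence of valid algorithms. -/
def AvgAchievable [MeasurableSpace 𝒳] [MeasurableSpace 𝒴]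
    (μ : Measure (ℕ → 𝒳)) (ν : Measure (ℕ → 𝒴)) (L : ℝ≥0∞) : Prop :=
  ∃ φ : (n : ℕ) → List 𝒳 → Option (Fin n → 𝒴),
    (∀ n : ℕ, Valid μ (fun y : Fin n → 𝒴 => cylP ν y) (φ n)) ∧
    limsup (fun n : ℕ =>
      (∑' m : ℕ, μ {ω | ∀ i ≤ m, φ n (preL ω i) = none}) / (n : ℝ≥0∞)) atTop ≤ L

/-- `L⋆(X,Y)` : the infimum average achievable rate over all valid algorithms. -/
def Lstar [MeasurableSpace 𝒳] [MeasurableSpace 𝒴]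
    (μ : Measure (ℕ → 𝒳)) (ν : Measure (ℕ → 𝒴)) : ℝ≥0∞ :=
  sInf {L : ℝ≥0∞ | AvgAchievable μ ν L}

/-- The spectral sup-entropy `H̄(X)`: the event `(1/m) log(1/P_{X^m}(X^m)) ≥ λ` is
`P_{X^m}(X^m) ≤ 2^{-mλ}`. -/
def specSup [MeasurableSpace 𝒳] (μ : Measure (ℕ → 𝒳)) : ℝ :=
  sInf {lam : ℝ | Tendsto (fun m : ℕ =>
    (μ {ω | cylP μ (pre ω m) ≤ (2 : ℝ) ^ (-((m : ℝ) * lam))}).toReal) atTop (nhds 0)}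

/-- The spectral inf-entropy `H̲(X)`: the event `(1/m) log(1/P_{X^m}(X^m)) ≤ λ` is
`P_{X^m}(X^m) ≥ 2^{-mλ}`. -/
def specInf [MeasurableSpace 𝒳] (μ : Measure (ℕ → 𝒳)) : ℝ :=
  sSup {lam : ℝ | Tendsto (fun m : ℕ =>
    (μ {ω | (2 : ℝ) ^ (-((m : ℝ) * lam)) ≤ cylP μ (pre ω m)}).toReal) atTop (nhds 0)}

/-- The (sup-)entropy rate `H(X) = limsup (1/m) H(X^m)`. -/
def entRate [MeasurableSpace 𝒳] [Fintype 𝒳] (μ : Measure (ℕ → 𝒳)) : ℝ :=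
  limsup (fun m : ℕ =>
    (∑ x : Fin m → 𝒳, cylP μ x * Real.logb 2 (1 / cylP μ x)) / (m : ℝ)) atTop

/-- Upper-tail condition: `Pr((1/m) log(1/P_{X^m}(X^m)) ≥ H̄(X)+δ) ≤ K/m²` eventually. -/
def UpperTail [MeasurableSpace 𝒳] (μ : Measure (ℕ → 𝒳)) : Prop :=
  ∀ δ : ℝ, 0 < δ → ∃ (K : ℝ) (m₀ : ℕ), ∀ m : ℕ, m₀ ≤ m →
    (μ {ω | cylP μ (pre ω m) ≤ (2 : ℝ) ^ (-((m : ℝ) * (specSup μ + δ)))}).toReal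
      ≤ K / (m : ℝ) ^ 2

/-- Lower-tail condition: `Pr((1/m) log(1/P_{X^m}(X^m)) ≤ H̲(X)−δ) ≤ K/m²` eventually. -/
def LowerTail [MeasurableSpace 𝒳] (μ : Measure (ℕ → 𝒳)) : Prop :=
  ∀ δ : ℝ, 0 < δ → ∃ (K : ℝ) (m₀ : ℕ), ∀ m : ℕ, m₀ ≤ m →
    (μ {ω | (2 : ℝ) ^ (-((m : ℝ) * (specInf μ - δ))) ≤ cylP μ (pre ω m)}).toReal
      ≤ K / (m : ℝ) ^ 2

/-- The finite-dimensional distributions of a Markov chain with initial distribution `q`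
and transition matrix `W` (`W x x'` is the transition probability from `x` to `x'`). -/
def markovP (q : 𝒳 → ℝ) (W : 𝒳 → 𝒳 → ℝ) : (m : ℕ) → (Fin m → 𝒳) → ℝ
  | 0, _ => 1
  | m + 1, x => q (x 0) * ∏ i : Fin m, W (x i.castSucc) (x i.succ)

/-- `μ` is the law of the Markov chain with initial distribution `q` and transition matrix `W`. -/
def IsMarkovMeasure [MeasurableSpace 𝒳] (μ : Measure (ℕ → 𝒳)) (q : 𝒳 → ℝ)
    (W : 𝒳 → 𝒳 → ℝ) : Prop :=
  ∀ (m : ℕ) (x : Fin m → 𝒳), cylP μ x = markovP q W m x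

/-- `W` is a (row-)stochastic transition matrix. -/
def IsTransMat [Fintype 𝒳] (W : 𝒳 → 𝒳 → ℝ) : Prop :=
  (∀ x x', 0 ≤ W x x') ∧ ∀ x, ∑ x', W x x' = 1

/-- Irreducibility: any state reaches any other in some `k ≥ 1` steps. -/
def IrreducibleMat [Fintype 𝒳] [DecidableEq 𝒳] (W : Matrix 𝒳 𝒳 ℝ) : Prop :=
  ∀ x x' : 𝒳, ∃ k : ℕ, 1 ≤ k ∧ 0 < (W ^ k) x x'

/-- `π` is a stationary distribution of `W`. -/
def IsStationary [Fintype 𝒳] (π : 𝒳 → ℝ) (W : 𝒳 → 𝒳 → ℝ) : Prop :=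
  (∀ x, 0 ≤ π x) ∧ (∑ x, π x = 1) ∧ ∀ x, ∑ x', π x' * W x' x = π x

/-- `q` is a probability distribution (initial distribution). -/
def IsInitial [Fintype 𝒳] (q : 𝒳 → ℝ) : Prop :=
  (∀ x, 0 ≤ q x) ∧ ∑ x, q x = 1

/-- The entropy rate `H^W(X) = Σ_{x',x} π(x') W(x|x') log (1/W(x|x'))` of a stationary
Markov chain. -/
def matEnt [Fintype 𝒳] (π : 𝒳 → ℝ) (W : 𝒳 → 𝒳 → ℝ) : ℝ :=
  ∑ x' : 𝒳, ∑ x : 𝒳, π x' * W x' x * Real.logb 2 (1 / W x' x)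

/-- The weight `w(ξ) = Pr(Y_1 ∈ 𝒴_ξ)` of the irreducible class `ξ` under the initial
distribution `q`, where `c` assigns to each state its class. -/
def wgt [Fintype 𝒴] {r : ℕ} (c : 𝒴 → Fin r) (q : 𝒴 → ℝ) (ξ : Fin r) : ℝ :=
  ∑ y ∈ Finset.univ.filter (fun y => c y = ξ), q y

/-- The binary entropy function (base 2). -/
def binEnt (t : ℝ) : ℝ := t * Real.logb 2 (1 / t) + (1 - t) * Real.logb 2 (1 / (1 - t))

end RNG

open RNG

namespace RNG

/-- The algorithm `φ`, run along the string sequence `s`, outputs `y` within `m` steps. -/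
def OutputsBy {A B : Type*} (φ : A → Option B) (s : ℕ → A) (m : ℕ) (y : B) : Prop :=
  ∃ i ≤ m, φ (s i) = some y ∧ ∀ j < i, φ (s j) = none

lemma OutputsBy.unique {A B : Type*} {φ : A → Option B} {s : ℕ → A} {m : ℕ} {y z : B}
    (hy : OutputsBy φ s m y) (hz : OutputsBy φ s m z) : y = z := by
  obtain ⟨i, -, hi, hi'⟩ := hy
  obtain ⟨j, -, hj, hj'⟩ := hz
  rcases lt_trichotomy i j with h | rfl | h
  · simp [hj' i h] at hi
  · simpa [hi] using hj
  · simp [hi' j h] at hj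

lemma exists_outputsBy {A B : Type*} {φ : A → Option B} {s : ℕ → A} {m : ℕ}
    (h : ¬ ∀ i ≤ m, φ (s i) = none) : ∃ y, OutputsBy φ s m y := by
  have hex : ∃ i, i ≤ m ∧ φ (s i) ≠ none := by push Not at h; exact h
  obtain ⟨hm, hne⟩ := Nat.find_spec hex
  obtain ⟨y, hy⟩ := Option.ne_none_iff_exists'.mp hne
  refine ⟨y, Nat.find hex, hm, hy, fun j hj => ?_⟩
  by_contra hj'
  exact Nat.find_min hex hj ⟨hj.le.trans hm, hj'⟩

lemma outputsBy_congr {A B : Type*} {φ : A → Option B} {s t : ℕ → A} {m : ℕ}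
    (h : ∀ i ≤ m, s i = t i) (y : B) : OutputsBy φ s m y ↔ OutputsBy φ t m y := by
  refine exists_congr fun i => and_congr_right fun hi => ?_
  rw [h i hi]
  refine and_congr_right fun _ => forall₂_congr fun j hj => ?_
  rw [h j (hj.le.trans hi)]

lemma take_ofFn_pre {𝒳 : Type*} (ω : ℕ → 𝒳) {i m : ℕ} (h : i ≤ m) :
    (List.ofFn (pre ω m)).take i = preL ω i := by
  apply List.ext_getElem
  · simp [preL, h]
  · intro k _ _
    simp [preL, pre]

lemma measurable_pre {𝒳 : Type*} [MeasurableSpace 𝒳] (m : ℕ) :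
    Measurable fun ω : ℕ → 𝒳 => pre ω m :=
  measurable_pi_lambda _ fun i => measurable_pi_apply (i : ℕ)

end RNG

/-- If a subprobability `q` and a probability `p` both dominate `r`, and `r` has mass at least
`1 - ε`, then `p` and `q` are within variational distance `ε`. -/
lemma half_sum_abs_sub_le {B : Type*} [Fintype B] {p q r : B → ℝ} {ε : ℝ}
    (hp : ∑ y, p y = 1) (hq : ∑ y, q y ≤ 1) (hrp : ∀ y, r y ≤ p y) (hrq : ∀ y, r y ≤ q y)
    (hr : 1 ≤ ε + ∑ y, r y) : (1 / 2) * ∑ y, |q y - p y| ≤ ε := by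
  have h : ∑ y, |q y - p y| ≤ ∑ y, ((q y - r y) + (p y - r y)) :=
    Finset.sum_le_sum fun y _ => by
      rw [abs_le]
      constructor <;> linarith [hrp y, hrq y]
  rw [Finset.sum_add_distrib, Finset.sum_sub_distrib, Finset.sum_sub_distrib] at h
  linarith

/-- **Proposition 1 (VL-RNG to FL-RNG conversion).** For any valid variable-length
random number generation algorithm `φ` generating `Y^n` (with law `PY` on the finite set
`B = 𝒴^n`) from the coin process `μ`, with stopping time `T`, and any `m ≥ 0`, there is a
fixed-length algorithm `ψ : 𝒳^m → 𝒴^n` whose approximation error (variational distance)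
satisfies `Δ_m = ‖P_{ψ(X^m)} − P_{Y^n}‖₁ ≤ Pr(T > m)`. -/
theorem VL_to_FL_conversion
    {𝒳 B : Type*} [Fintype 𝒳] [MeasurableSpace 𝒳] [DiscreteMeasurableSpace 𝒳]
    [Fintype B] [Nonempty B]
    (μ : Measure (ℕ → 𝒳)) [IsProbabilityMeasure μ]
    (PY : B → ℝ) (hPY0 : ∀ y, 0 ≤ PY y) (hPY1 : ∑ y : B, PY y = 1)
    (φ : List 𝒳 → Option B) (hvalid : Valid μ PY φ) (m : ℕ) :
    ∃ ψ : (Fin m → 𝒳) → B,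
      (1 / 2) * ∑ y : B, |(μ {ω | ψ (pre ω m) = y}).toReal - PY y|
        ≤ (μ {ω | ∀ i ≤ m, φ (preL ω i) = none}).toReal := by
  let outputEvent (y : B) : Set (ℕ → 𝒳) := {ω | OutputsBy φ (preL ω) m y}
  let ψ (x : Fin m → 𝒳) : B := Classical.epsilon (OutputsBy φ ((List.ofFn x).take ·) m)
  have hψ {ω : ℕ → 𝒳} {y : B} (h : OutputsBy φ (preL ω) m y) : ψ (pre ω m) = y := by
    have h' := (outputsBy_congr (fun _ => take_ofFn_pre ω) y).mpr h
    exact (Classical.epsilon_spec ⟨y, h'⟩).unique h'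
  refine ⟨ψ, half_sum_abs_sub_le (r := fun y => μ.real (outputEvent y)) hPY1 ?_ ?_ ?_ ?_⟩
  · have hsum := sum_measureReal_preimage_singleton (μ := μ) (Finset.univ : Finset B)
      (f := fun ω => ψ (pre ω m)) fun y _ =>
        measurable_pre m (Set.toFinite (ψ ⁻¹' {y})).measurableSet
    exact hsum.trans_le measureReal_le_one
  · intro y
    rw [← hvalid y]
    exact measureReal_mono fun ω ⟨i, _, h⟩ => ⟨i, h⟩
  · exact fun y => measureReal_mono fun ω h => hψ h
  · have hcover : {ω | ∀ i ≤ m, φ (preL ω i) = none} ∪ ⋃ y, outputEvent y = Set.univ := by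
      refine Set.eq_univ_of_forall fun ω => or_iff_not_imp_left.mpr fun h => ?_
      exact Set.mem_iUnion.mpr (exists_outputsBy h)
    calc (1 : ℝ) = μ.real ({ω | ∀ i ≤ m, φ (preL ω i) = none} ∪ ⋃ y, outputEvent y) := by
          rw [hcover, probReal_univ]
      _ ≤ _ := (measureReal_union_le _ _).trans
          (add_le_add_right (measureReal_iUnion_fintype_le _) _)
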